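/- arXiv:2409.10908 — 6 statements merged into one kernel-verified Lean document; each statement's English description precedes it below -/
import Mathlib

section
/- There exists a constant C > 0 such that for every integer n ≥ 2, every integer k with 2 ≤ k ≤ n, every real B ≥ 1, and every δ ∈ (0,1), there is a non-adaptive randomized algorithm making at most C · (B² · n · log(k/δ) + B · k · log⁴(k/δ)) subset queries, each query being a subset of size at most C · k · log k, which, for every B-balanced k-clustering of an n-point set U, outputs exactly that partition with probability at least 1 − δ. -/
open scoped ENNReal

/-- `count(S)`: the number of clusters (under the cluster labeling `c`) intersecting
the query set `S`. -/
def clusterCount {U K : Type*} [DecidableEq K] (c : U → K) (S : Finset U) : ℕ :=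
  (S.image c).card

/-- A `k`-clustering of `Fin n` (given by the labeling `c`) is `B`-balanced if every
cluster has size between `n/(Bk)` and `Bn/k`. -/
def IsBalanced {n k : ℕ} (B : ℝ) (c : Fin n → Fin k) : Prop :=
  ∀ j : Fin k,
    (n : ℝ) / (B * k) ≤ ((Finset.univ.filter (fun x => c x = j)).card : ℝ) ∧
    ((Finset.univ.filter (fun x => c x = j)).card : ℝ) ≤ B * n / k

lemma pow_succ_add_mul_le_add_pow_succ (a b r : ℕ) :
    b ^ (r + 1) + (r + 1) * a * b ^ r ≤ (a + b) ^ (r + 1) := by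
  induction r with
  | zero => simp [add_comm]
  | succ r ih =>
    calc b ^ (r + 1 + 1) + (r + 1 + 1) * a * b ^ (r + 1)
        ≤ (b ^ (r + 1) + (r + 1) * a * b ^ r) * (a + b) := by
          have h : 0 ≤ (r + 1) * a * b ^ r * a := Nat.zero_le _
          linear_combination h
      _ ≤ (a + b) ^ (r + 1) * (a + b) := Nat.mul_le_mul_right _ ih
      _ = (a + b) ^ (r + 1 + 1) := (pow_succ _ _).symm

/-- Number of tuples hitting `A` and missing `B`, bounded below by the tuples hitting `A`
exactly once. -/
lemma le_card_hit_and_miss {U : Type*} [Fintype U] [DecidableEq U] {A B : Finset U}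
    (h : Disjoint A B) (r : ℕ) :
    (r + 1) * A.card * (A ∪ B)ᶜ.card ^ r ≤
      (Finset.univ.filter
        (fun f : Fin (r + 1) → U => (∃ i, f i ∈ A) ∧ ∀ i, f i ∉ B)).card := by
  have hsub : Fintype.piFinset (fun _ : Fin (r + 1) => (A ∪ B)ᶜ) ⊆
      Fintype.piFinset (fun _ : Fin (r + 1) => Bᶜ) :=
    Fintype.piFinset_subset _ _ fun _ =>
      Finset.compl_subset_compl.2 Finset.subset_union_right
  have heq : Finset.univ.filter
        (fun f : Fin (r + 1) → U => (∃ i, f i ∈ A) ∧ ∀ i, f i ∉ B) =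
      Fintype.piFinset (fun _ : Fin (r + 1) => Bᶜ) \
        Fintype.piFinset (fun _ : Fin (r + 1) => (A ∪ B)ᶜ) := by
    ext f
    simp only [Finset.mem_filter, Finset.mem_univ, true_and, Finset.mem_sdiff,
      Fintype.mem_piFinset, Finset.mem_compl, Finset.mem_union, not_forall, not_not]
    constructor
    · rintro ⟨⟨i, hi⟩, hB⟩
      exact ⟨hB, i, Or.inl hi⟩
    · rintro ⟨hB, i, hi⟩
      exact ⟨⟨i, hi.resolve_right (hB i)⟩, hB⟩
  have hcard : Bᶜ.card = A.card + (A ∪ B)ᶜ.card := by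
    have h1 := Finset.card_add_card_compl B
    have h2 := Finset.card_add_card_compl (A ∪ B)
    rw [Finset.card_union_of_disjoint h] at h2
    omega
  have := pow_succ_add_mul_le_add_pow_succ A.card (A ∪ B)ᶜ.card r
  rw [heq, Finset.card_sdiff_of_subset hsub, Fintype.card_piFinset_const,
    Fintype.card_piFinset_const, hcard]
  omega

/-- The tuple `f` meets cluster `i` and avoids cluster `j`. -/
def Separates {n k r : ℕ} (c : Fin n → Fin k) (i j : Fin k) (f : Fin r → Fin n) : Prop :=
  (∃ s, c (f s) = i) ∧ ∀ s, c (f s) ≠ j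

open Classical in
lemma IsBalanced.card_separates_ge {n k : ℕ} {B : ℝ} {c : Fin n → Fin k} (hn : 0 < n)
    (hB : 1 ≤ B) (hc : IsBalanced B c) {i j : Fin k} (hij : i ≠ j) :
    (n : ℝ) ^ (⌊(k : ℝ) / (4 * B)⌋₊ + 1) / (8 * B ^ 2) ≤
      ((Finset.univ.filter
        (fun f : Fin (⌊(k : ℝ) / (4 * B)⌋₊ + 1) → Fin n => Separates c i j f)).card : ℝ) := by
  have hk : (0 : ℝ) < k := by exact_mod_cast i.pos
  have hn' : (0 : ℝ) < n := by exact_mod_cast hn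
  have hB0 : (0 : ℝ) < B := by linarith
  set r := ⌊(k : ℝ) / (4 * B)⌋₊ with hr
  have hr1 : (r : ℝ) ≤ k / (4 * B) := Nat.floor_le (by positivity)
  have hr2 : (k : ℝ) / (4 * B) ≤ r + 1 := (Nat.lt_floor_add_one _).le
  set A := Finset.univ.filter (fun x => c x = i) with hA
  set A' := Finset.univ.filter (fun x => c x = j) with hA'
  have hdisj : Disjoint A A' := by
    refine Finset.disjoint_filter.2 fun x _ h1 h2 => hij (h1.symm.trans h2)
  have hcount := le_card_hit_and_miss hdisj r
  have hset : (Finset.univ.filter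
      (fun f : Fin (r + 1) → Fin n => (∃ s, f s ∈ A) ∧ ∀ s, f s ∉ A')) =
      Finset.univ.filter (fun f : Fin (r + 1) → Fin n => Separates c i j f) := by
    ext f
    rw [Finset.mem_filter, Finset.mem_filter]
    simp [Separates, hA, hA']
  rw [hset] at hcount
  have hsum : (A.card : ℝ) + A'.card + ((A ∪ A')ᶜ.card : ℝ) = n := by
    have h2 := Finset.card_add_card_compl (A ∪ A')
    rw [Finset.card_union_of_disjoint hdisj, Fintype.card_fin] at h2
    exact_mod_cast h2
  set b : ℝ := ((A ∪ A')ᶜ.card : ℝ) with hb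
  have hb0 : 0 ≤ b := by positivity
  have hbern : 1 / 2 ≤ (b / n) ^ r := by
    have h1 := one_add_mul_le_pow (a := b / n - 1) (by
      have : 0 ≤ b / n := by positivity
      linarith) r
    rw [add_sub_cancel] at h1
    have hub : 1 - b / n ≤ 2 * B / k := by
      have h3 : (A.card : ℝ) + A'.card ≤ 2 * (B * n / k) := by
        linarith [(hc i).2, (hc j).2]
      have : 1 - b / n = ((A.card : ℝ) + A'.card) / n := by
        rw [← hsum] at hn' ⊢
        field_simp
        ring
      rw [this, div_le_iff₀ hn']
      calc _ ≤ _ := h3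
        _ = _ := by ring
    have h4 : (r : ℝ) * (1 - b / n) ≤ k / (4 * B) * (2 * B / k) :=
      mul_le_mul hr1 hub (by
        have : b / n ≤ 1 := by
          rw [div_le_one hn']
          have : (0 : ℝ) ≤ A.card := by positivity
          have : (0 : ℝ) ≤ A'.card := by positivity
          linarith
        linarith) (by positivity)
    have h5 : (k : ℝ) / (4 * B) * (2 * B / k) = 1 / 2 := by field_simp; norm_num
    linarith
  have hbr : (n : ℝ) ^ r / 2 ≤ b ^ r := by
    rw [div_pow, le_div_iff₀ (by positivity)] at hbern
    linarith
  calc (n : ℝ) ^ (r + 1) / (8 * B ^ 2)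
      = k / (4 * B) * (n / (B * k)) * (n ^ r / 2) := by field_simp; ring
    _ ≤ (r + 1) * A.card * b ^ r := by
      gcongr
      exact (hc i).1
    _ ≤ _ := by rw [hb]; exact_mod_cast hcount

lemma clusterCount_insert_ne_of_separates {n k r : ℕ} {c : Fin n → Fin k} {x y : Fin n}
    {f : Fin r → Fin n} (h : Separates c (c x) (c y) f) :
    clusterCount c (insert x (Finset.univ.image f)) ≠
      clusterCount c (insert y (Finset.univ.image f)) := by
  obtain ⟨⟨s, hs⟩, hy⟩ := h
  have h1 : c x ∈ (Finset.univ.image f).image c := by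
    simp only [Finset.mem_image, Finset.mem_univ, true_and, exists_exists_eq_and]
    exact ⟨s, hs⟩
  have h2 : c y ∉ (Finset.univ.image f).image c := by
    simpa only [Finset.mem_image, Finset.mem_univ, true_and, exists_exists_eq_and,
      not_exists] using hy
  simp only [clusterCount, Finset.image_insert]
  rw [Finset.insert_eq_of_mem h1, Finset.card_insert_of_notMem h2]
  omega

/-- Query number `(s, x)` is the tuple `F s` together with the point `x`. -/
def augmentedQueries {n r l : ℕ} (F : Fin l → Fin r → Fin n) (q : Fin (l * n)) :
    Finset (Fin n) :=
  insert (finProdFinEquiv.symm q).2 (Finset.univ.image (F (finProdFinEquiv.symm q).1))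

/-- Points are identified when all their answers agree. -/
def decodeAnswers {n l : ℕ} (a : Fin (l * n) → ℕ) : Setoid (Fin n) :=
  Setoid.ker fun x s => a (finProdFinEquiv (s, x))

lemma decodeAnswers_eq_ker {n k r l : ℕ} {c : Fin n → Fin k} {F : Fin l → Fin r → Fin n}
    (h : ∀ i j, i ≠ j → ∃ s, Separates c i j (F s)) :
    decodeAnswers (fun q => clusterCount c (augmentedQueries F q)) = Setoid.ker c := by
  ext x y
  rw [decodeAnswers, Setoid.ker_def, Setoid.ker_def, funext_iff]
  simp only [augmentedQueries, Equiv.symm_apply_apply]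
  constructor
  · intro hxy
    by_contra hne
    obtain ⟨s, hs⟩ := h _ _ hne
    exact clusterCount_insert_ne_of_separates hs (hxy s)
  · intro hxy s
    simp only [clusterCount, Finset.image_insert, hxy]

open Classical in
/-- Union bound: few sequences of tuples fail to separate some pair of clusters. -/
lemma IsBalanced.card_not_separating_le {n k l : ℕ} {B : ℝ} {c : Fin n → Fin k} (hn : 0 < n)
    (hB : 1 ≤ B) (hc : IsBalanced B c) :
    ((Finset.univ.filter (fun F : Fin l → Fin (⌊(k : ℝ) / (4 * B)⌋₊ + 1) → Fin n =>
      ¬ ∀ i j, i ≠ j → ∃ s, Separates c i j (F s))).card : ℝ) ≤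
      (k : ℝ) ^ 2 * Real.exp (-(l / (8 * B ^ 2))) *
        Fintype.card (Fin l → Fin (⌊(k : ℝ) / (4 * B)⌋₊ + 1) → Fin n) := by
  have hpair : ∀ p : Fin k × Fin k, p.1 ≠ p.2 →
      ((Fintype.piFinset fun _ : Fin l => Finset.univ.filter
        fun f : Fin (⌊(k : ℝ) / (4 * B)⌋₊ + 1) → Fin n =>
          ¬ Separates c p.1 p.2 f).card : ℝ) ≤
      Real.exp (-(l / (8 * B ^ 2))) *
        Fintype.card (Fin l → Fin (⌊(k : ℝ) / (4 * B)⌋₊ + 1) → Fin n) := by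
    rintro ⟨i, j⟩ hij
    have h1 := hc.card_separates_ge hn hB hij
    have h2 := Finset.card_filter_add_card_filter_not (s := Finset.univ)
      (fun f : Fin (⌊(k : ℝ) / (4 * B)⌋₊ + 1) → Fin n => Separates c i j f)
    set r := ⌊(k : ℝ) / (4 * B)⌋₊
    have h3 : ((Finset.univ.filter fun f : Fin (r + 1) → Fin n =>
        ¬ Separates c i j f).card : ℝ) ≤ Real.exp (-(1 / (8 * B ^ 2))) * (n : ℝ) ^ (r + 1) := by
      have h4 : ((Finset.univ.filter fun f : Fin (r + 1) → Fin n =>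
          Separates c i j f).card : ℝ) + ((Finset.univ.filter fun f : Fin (r + 1) → Fin n =>
          ¬ Separates c i j f).card : ℝ) = (n : ℝ) ^ (r + 1) := by
        rw [Finset.card_univ, Fintype.card_fun, Fintype.card_fin, Fintype.card_fin] at h2
        exact_mod_cast h2
      have h5 := Real.add_one_le_exp (-(1 / (8 * B ^ 2)))
      have h6 : (0 : ℝ) ≤ (n : ℝ) ^ (r + 1) := by positivity
      have h7 := mul_le_mul_of_nonneg_right h5 h6
      have h8 : (n : ℝ) ^ (r + 1) / (8 * B ^ 2) = 1 / (8 * B ^ 2) * (n : ℝ) ^ (r + 1) := by ring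
      linarith
    rw [Fintype.card_piFinset_const, Fintype.card_fun, Fintype.card_fun, Fintype.card_fin,
      Fintype.card_fin, Fintype.card_fin]
    push_cast
    calc _ ≤ (Real.exp (-(1 / (8 * B ^ 2))) * (n : ℝ) ^ (r + 1)) ^ l := by gcongr
      _ = _ := by
        rw [mul_pow, ← Real.exp_nat_mul]
        congr 2
        ring
  have hsub : (Finset.univ.filter (fun F : Fin l → Fin (⌊(k : ℝ) / (4 * B)⌋₊ + 1) → Fin n =>
      ¬ ∀ i j, i ≠ j → ∃ s, Separates c i j (F s))) ⊆
      (Finset.univ.filter fun p : Fin k × Fin k => p.1 ≠ p.2).biUnion fun p =>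
        Fintype.piFinset fun _ : Fin l => Finset.univ.filter fun f => ¬ Separates c p.1 p.2 f := by
    intro F hF
    simp only [Finset.mem_filter, Finset.mem_univ, true_and] at hF
    push Not at hF
    obtain ⟨i, j, hij, h⟩ := hF
    simp only [Finset.mem_biUnion, Fintype.mem_piFinset, Finset.mem_filter, Finset.mem_univ,
      true_and]
    exact ⟨(i, j), hij, h⟩
  have h1 : ((Finset.univ.filter
      (fun F : Fin l → Fin (⌊(k : ℝ) / (4 * B)⌋₊ + 1) → Fin n =>
      ¬ ∀ i j, i ≠ j → ∃ s, Separates c i j (F s))).card : ℝ) ≤ _ :=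
    Nat.cast_le.2 ((Finset.card_le_card hsub).trans Finset.card_biUnion_le)
  refine h1.trans ?_
  push_cast
  refine (Finset.sum_le_card_nsmul _ _ _ fun p hp => hpair p (Finset.mem_filter.1 hp).2).trans ?_
  rw [nsmul_eq_mul, mul_assoc]
  gcongr
  have := Finset.card_filter_le (Finset.univ : Finset (Fin k × Fin k)) (fun p => p.1 ≠ p.2)
  rw [Finset.card_univ, Fintype.card_prod, Fintype.card_fin] at this
  rw [sq]
  exact_mod_cast this

lemma one_sub_le_toOuterMeasure_uniformOfFintype {α : Type*} [Fintype α] [Nonempty α]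
    {δ : ℝ} (p : α → Prop) [DecidablePred p]
    (h : ((Finset.univ.filter fun a => ¬ p a).card : ℝ) ≤ δ * Fintype.card α) :
    ENNReal.ofReal (1 - δ) ≤ (PMF.uniformOfFintype α).toOuterMeasure {a | p a} := by
  classical
  have hpos : (0 : ℝ) < Fintype.card α := by exact_mod_cast Fintype.card_pos
  have hsum := Finset.card_filter_add_card_filter_not (s := (Finset.univ : Finset α)) p
  have hsum' : ((Finset.univ.filter p).card : ℝ) + (Finset.univ.filter fun a => ¬ p a).card =
      Fintype.card α := by
    rw [Finset.card_univ] at hsum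
    exact_mod_cast hsum
  have hle : 1 - δ ≤ ((Finset.univ.filter p).card : ℝ) / Fintype.card α := by
    rw [le_div_iff₀ hpos]
    linarith
  rw [PMF.toOuterMeasure_uniformOfFintype_apply]
  refine (ENNReal.ofReal_le_ofReal hle).trans_eq ?_
  rw [ENNReal.ofReal_div_of_pos hpos, ENNReal.ofReal_natCast, ENNReal.ofReal_natCast]
  congr 2
  exact (Fintype.card_subtype p).symm.trans (Fintype.card_congr (Equiv.refl _))

/-- There is a constant `C > 0` such that for all `n ≥ 2`, `2 ≤ k ≤ n`, `B ≥ 1`,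
`δ ∈ (0,1)`, there is a non-adaptive randomized algorithm making at most
`C·(B²·n·log₂(k/δ) + B·k·log₂⁴(k/δ))` subset queries, each of size at most
`C·k·log₂ k`, which for every `B`-balanced `k`-clustering of an `n`-point set outputs
exactly that partition with probability at least `1 - δ`. -/
theorem nonadaptive_balanced_clustering_first :
    ∃ C : ℝ, 0 < C ∧
      ∀ n k : ℕ, 2 ≤ n → 2 ≤ k → k ≤ n →
        ∀ B : ℝ, 1 ≤ B →
          ∀ δ : ℝ, 0 < δ → δ < 1 →
            ∃ m : ℕ,
              (m : ℝ) ≤ C * (B ^ 2 * n * Real.logb 2 (k / δ) +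
                  B * k * (Real.logb 2 (k / δ)) ^ 4) ∧
              ∃ D : PMF ((Fin m → Finset (Fin n)) × ((Fin m → ℕ) → Setoid (Fin n))),
                (∀ a ∈ D.support, ∀ i : Fin m,
                    ((a.1 i).card : ℝ) ≤ C * k * Real.logb 2 k) ∧
                ∀ c : Fin n → Fin k, IsBalanced B c →
                  ENNReal.ofReal (1 - δ) ≤
                    D.toOuterMeasure
                      {a | a.2 (fun i => clusterCount c (a.1 i)) = Setoid.ker c} := by
  classical
  refine ⟨34, by norm_num, fun n k hn hk hkn B hB δ hδ0 hδ1 => ?_⟩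
  have hB0 : (0 : ℝ) < B := by linarith
  have hk2 : (2 : ℝ) ≤ k := by exact_mod_cast hk
  have hn0 : (0 : ℝ) < n := by positivity
  have hx2 : 2 ≤ (k : ℝ) / δ := by
    rw [le_div_iff₀ hδ0]
    nlinarith
  have hL1 : 1 ≤ Real.logb 2 (k / δ) := by
    rw [Real.le_logb_iff_rpow_le (by norm_num) (by linarith)]
    simpa using hx2
  have hlogk : 1 ≤ Real.logb 2 k := by
    rw [Real.le_logb_iff_rpow_le (by norm_num) (by linarith)]
    simpa using hk2
  set L := Real.logb 2 (k / δ) with hL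
  have hlogL : Real.log (k / δ) ≤ L := by
    rw [hL, Real.logb, le_div_iff₀ (Real.log_pos (by norm_num))]
    have h1 : 0 ≤ Real.log (k / δ) := Real.log_nonneg (by linarith)
    have h2 := Real.log_two_lt_d9
    nlinarith
  set l := ⌈16 * B ^ 2 * L⌉₊ with hl
  have hl1 : 16 * B ^ 2 * L ≤ l := Nat.le_ceil _
  have hl2 : (l : ℝ) ≤ 17 * (B ^ 2 * L) := by
    have h1 := (Nat.ceil_lt_add_one (show 0 ≤ 16 * B ^ 2 * L by positivity)).le
    have h2 : 1 ≤ B ^ 2 * L := one_le_mul_of_one_le_of_one_le (one_le_pow₀ hB) hL1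
    linarith
  have : NeZero n := ⟨by omega⟩
  refine ⟨l * n, ?_, (PMF.uniformOfFintype
    (Fin l → Fin (⌊(k : ℝ) / (4 * B)⌋₊ + 1) → Fin n)).map
      (fun F => (augmentedQueries F, decodeAnswers)), ?_, ?_⟩
  · have h1 : (l : ℝ) * n ≤ 17 * (B ^ 2 * L) * n := by gcongr
    have h2 : 0 ≤ B ^ 2 * n * L := by positivity
    have h3 : 0 ≤ B * k * L ^ 4 := by positivity
    push_cast
    linarith
  · intro a ha q
    rw [PMF.mem_support_map_iff] at ha
    obtain ⟨F, -, rfl⟩ := ha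
    have h1 : (augmentedQueries F q).card ≤ ⌊(k : ℝ) / (4 * B)⌋₊ + 1 + 1 :=
      (Finset.card_insert_le _ _).trans
        (Nat.succ_le_succ (Finset.card_image_le.trans (by simp)))
    have h2 : (⌊(k : ℝ) / (4 * B)⌋₊ : ℝ) ≤ k :=
      (Nat.floor_le (by positivity)).trans (div_le_self (by positivity) (by linarith))
    have h3 : ((augmentedQueries F q).card : ℝ) ≤ (⌊(k : ℝ) / (4 * B)⌋₊ : ℝ) + 1 + 1 := by
      exact_mod_cast h1
    show ((augmentedQueries F q).card : ℝ) ≤ _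
    nlinarith
  · intro c hc
    rw [PMF.toOuterMeasure_map_apply]
    refine (one_sub_le_toOuterMeasure_uniformOfFintype
      (fun F : Fin l → Fin (⌊(k : ℝ) / (4 * B)⌋₊ + 1) → Fin n =>
        ∀ i j, i ≠ j → ∃ s, Separates c i j (F s)) ?_).trans
        (MeasureTheory.measure_mono fun F hF => Set.mem_preimage.2 (decodeAnswers_eq_ker hF))
    refine (hc.card_not_separating_le (by omega) hB).trans ?_
    gcongr
    have h1 : 2 * Real.log (k / δ) ≤ l / (8 * B ^ 2) := by
      rw [le_div_iff₀ (by positivity)]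
      have : Real.log (k / δ) * (16 * B ^ 2) ≤ L * (16 * B ^ 2) := by gcongr
      linarith
    have h2 : Real.exp (-(l / (8 * B ^ 2))) ≤ (δ / k) ^ 2 := by
      rw [← Real.le_log_iff_exp_le (by positivity), Real.log_pow, ← inv_div (k : ℝ), Real.log_inv]
      push_cast
      linarith
    calc (k : ℝ) ^ 2 * Real.exp (-(l / (8 * B ^ 2))) ≤ k ^ 2 * (δ / k) ^ 2 := by gcongr
      _ = δ * δ := by field_simp
      _ ≤ δ := mul_le_of_le_one_left hδ0.le hδ1.le
end

section
/- There exists a constant C > 0 such that for every integer n ≥ 2 and every integer k with 2 ≤ k ≤ n, there is a two-round deterministic algorithm making at most C · n · log k subset queries in total which, for every partition of an n-point set U into at most k clusters, outputs exactly that partition (with certainty). -/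
/-- Adding a point leaves the count unchanged exactly when its cluster is already met. -/
theorem clusterCount_insert_eq_iff {U K : Type*} [DecidableEq U] [DecidableEq K] (c : U → K)
    (x : U) (S : Finset U) :
    clusterCount c (insert x S) = clusterCount c S ↔ ∃ r ∈ S, c r = c x := by
  unfold clusterCount
  rw [Finset.image_insert]
  by_cases h : c x ∈ S.image c
  · rw [Finset.insert_eq_of_mem h]
    simpa using h
  · rw [Finset.card_insert_of_notMem h]
    simpa using h

/-- `i` is a strict record of the sequence `a`. -/
def IsRecord {n : ℕ} (a : Fin n → ℕ) (i : Fin n) : Prop :=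
  ∀ j < i, a j < a i

/-- The strict records of the prefix counts are the first elements of the clusters. -/
theorem isRecord_clusterCount_Iic_iff {n : ℕ} {K : Type*} [DecidableEq K] (c : Fin n → K)
    (i : Fin n) :
    IsRecord (fun j => clusterCount c (Finset.Iic j)) i ↔ ∀ j < i, c j ≠ c i := by
  constructor
  · intro h j hj hc
    have hpos : j.val < i.val := hj
    obtain ⟨p, hp⟩ : ∃ p : Fin n, p.val = i.val - 1 := ⟨⟨i.val - 1, by omega⟩, rfl⟩
    refine absurd (h p (Fin.lt_def.2 (by omega))) (not_lt.2 (Finset.card_le_card fun y hy => ?_))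
    obtain ⟨m, hm, rfl⟩ := Finset.mem_image.1 hy
    rw [Finset.mem_Iic, Fin.le_def] at hm
    rcases hm.lt_or_eq with hm | hm
    · exact Finset.mem_image_of_mem _ (Finset.mem_Iic.2 (Fin.le_def.2 (by omega)))
    · rw [Fin.ext hm, ← hc]
      exact Finset.mem_image_of_mem _ (Finset.mem_Iic.2 (Fin.le_def.2 (by omega)))
  · intro h j hj
    refine Finset.card_lt_card (Finset.ssubset_iff_subset_ne.2
      ⟨Finset.image_subset_image (Finset.Iic_subset_Iic.2 hj.le), fun he => ?_⟩)
    have hi : c i ∈ (Finset.Iic j).image c :=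
      he ▸ Finset.mem_image_of_mem _ (Finset.mem_Iic.2 le_rfl)
    obtain ⟨m, hm, hmc⟩ := Finset.mem_image.1 hi
    exact h m ((Finset.mem_Iic.1 hm).trans_lt hj) hmc

/-- Distinct strict records have distinct values. -/
theorem IsRecord.eq_of_apply_eq {n : ℕ} {a : Fin n → ℕ} {i j : Fin n} (hi : IsRecord a i)
    (hj : IsRecord a j) (h : a i = a j) : i = j := by
  rcases lt_trichotomy i j with hij | hij | hij
  · exact absurd h (hj i hij).ne
  · exact hij
  · exact absurd h (hi j hij).ne'

/-- Every cluster contains a first element. -/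
theorem exists_first_of_cluster {n : ℕ} {K : Type*} (c : Fin n → K) (x : Fin n) :
    ∃ r, c r = c x ∧ ∀ j < r, c j ≠ c r := by
  obtain ⟨r, hr, hmin⟩ := WellFounded.has_min (wellFounded_lt (α := Fin n))
    {r | c r = c x} ⟨x, rfl⟩
  exact ⟨r, hr, fun j hj hc => hmin j (hc.trans hr) hj⟩

open Classical in
/-- The strict records of `a` whose value has a `1` at binary position `b`. -/
noncomputable def recordsWithBit {n : ℕ} (a : Fin n → ℕ) (b : ℕ) : Finset (Fin n) :=
  Finset.univ.filter fun r => IsRecord a r ∧ (a r).testBit b = true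

theorem mem_recordsWithBit {n : ℕ} {a : Fin n → ℕ} {b : ℕ} {r : Fin n} :
    r ∈ recordsWithBit a b ↔ IsRecord a r ∧ (a r).testBit b = true := by
  simp [recordsWithBit]

/-- Points of different clusters are told apart by adding each of them to the sets of
first elements selected by the binary digits of their prefix counts. -/
theorem eq_of_clusterCount_insert_recordsWithBit {n k L : ℕ} (hL : k < 2 ^ L)
    (c : Fin n → Fin k) {x y : Fin n}
    (h : ∀ b < L,
      clusterCount c (insert x (recordsWithBit (fun i => clusterCount c (Finset.Iic i)) b)) =
      clusterCount c (insert y (recordsWithBit (fun i => clusterCount c (Finset.Iic i)) b))) :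
    c x = c y := by
  set a : Fin n → ℕ := fun i => clusterCount c (Finset.Iic i)
  have hlt : ∀ i, a i < 2 ^ L := fun i =>
    ((Finset.card_le_univ _).trans_eq (Fintype.card_fin k)).trans_lt hL
  have key : ∀ z r : Fin n, c r = c z → (∀ j < r, c j ≠ c r) → ∀ b,
      (clusterCount c (insert z (recordsWithBit a b)) = clusterCount c (recordsWithBit a b) ↔
        (a r).testBit b = true) := by
    intro z r hrz hr b
    have hrec : IsRecord a r := (isRecord_clusterCount_Iic_iff c r).2 hr
    rw [clusterCount_insert_eq_iff]
    constructor
    · rintro ⟨s, hs, hsz⟩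
      obtain ⟨hs, hbit⟩ := mem_recordsWithBit.1 hs
      have hs' := (isRecord_clusterCount_Iic_iff c s).1 hs
      have hsr : s = r := by
        rcases lt_trichotomy s r with hlt' | heq | hlt'
        · exact absurd (hsz.trans hrz.symm) (hr s hlt')
        · exact heq
        · exact absurd (hrz.trans hsz.symm) (hs' r hlt')
      exact hsr ▸ hbit
    · exact fun hbit => ⟨r, mem_recordsWithBit.2 ⟨hrec, hbit⟩, hrz⟩
  obtain ⟨r, hrx, hr⟩ := exists_first_of_cluster c x
  obtain ⟨s, hsy, hs⟩ := exists_first_of_cluster c y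
  have hrs : a r = a s := by
    refine Nat.eq_of_testBit_eq fun b => ?_
    rcases lt_or_ge b L with hb | hb
    · rw [Bool.eq_iff_iff, ← key x r hrx hr b, ← key y s hsy hs b, h b hb]
    · have hpow : 2 ^ L ≤ 2 ^ b := Nat.pow_le_pow_right (by norm_num) hb
      rw [Nat.testBit_lt_two_pow ((hlt r).trans_le hpow),
        Nat.testBit_lt_two_pow ((hlt s).trans_le hpow)]
  have : r = s := IsRecord.eq_of_apply_eq ((isRecord_clusterCount_Iic_iff c r).2 hr)
    ((isRecord_clusterCount_Iic_iff c s).2 hs) hrs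
  rw [← hrx, ← hsy, this]

/-- There is a constant `C > 0` such that for all `n ≥ 2` and `2 ≤ k ≤ n`, there is a
two-round deterministic algorithm (a first-round query sequence, a map from first-round
answers to a second-round query sequence, and a decoder) making at most `C·n·log₂ k`
subset queries in total, which for every partition of an `n`-point set into at most `k`
clusters outputs exactly that partition. -/
theorem two_round_deterministic_clustering :
    ∃ C : ℝ, 0 < C ∧
      ∀ n k : ℕ, 2 ≤ n → 2 ≤ k → k ≤ n →
        ∃ m₁ m₂ : ℕ,
          ((m₁ : ℝ) + (m₂ : ℝ)) ≤ C * n * Real.logb 2 k ∧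
          ∃ (Q₁ : Fin m₁ → Finset (Fin n))
            (Q₂ : (Fin m₁ → ℕ) → Fin m₂ → Finset (Fin n))
            (g : (Fin m₁ → ℕ) → (Fin m₂ → ℕ) → Setoid (Fin n)),
            ∀ c : Fin n → Fin k,
              g (fun i => clusterCount c (Q₁ i))
                (fun j => clusterCount c
                  (Q₂ (fun i => clusterCount c (Q₁ i)) j)) = Setoid.ker c := by
  refine ⟨3, by norm_num, fun n k _ hk _ => ⟨n, n * (Nat.log 2 k + 1), ?_, Finset.Iic,
    fun a j => insert (finProdFinEquiv.symm j).1
      (recordsWithBit a (finProdFinEquiv.symm j).2.val),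
    fun _ w => Setoid.ker fun x b => w (finProdFinEquiv (x, b)), fun c => ?_⟩⟩
  · have hlog : (Nat.log 2 k : ℝ) ≤ Real.logb 2 k := by
      exact_mod_cast Real.natLog_le_logb k 2
    have hone : (1 : ℝ) ≤ Real.logb 2 k := by
      rw [Real.le_logb_iff_rpow_le (by norm_num) (by positivity)]
      simpa using (by exact_mod_cast hk : (2 : ℝ) ≤ k)
    have hsum : (1 : ℝ) + (Nat.log 2 k + 1) ≤ 3 * Real.logb 2 k := by linarith
    push_cast
    nlinarith [mul_le_mul_of_nonneg_left hsum (Nat.cast_nonneg (α := ℝ) n)]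
  · ext x y
    simp only [Setoid.ker_def, Equiv.symm_apply_apply]
    constructor
    · intro h
      exact eq_of_clusterCount_insert_recordsWithBit (Nat.lt_pow_succ_log_self (by norm_num) k) c
        fun b hb => congrFun h ⟨b, hb⟩
    · intro h
      funext b
      simp only [clusterCount, Finset.image_insert, h]
end

section
/- For every integer N ≥ 1 and every real α ∈ (0,1], the following inequality holds: Σ_{t=1}^{N−1} C(N,t) · (α/(3N))^{(2/N)·t(N−t)} ≤ α, where C(N,t) denotes the binomial coefficient. (This is the union-bound estimate over all cuts showing that an Erdős–Rényi graph with edge probability p ≥ 1 − (α/(3N))^{2/N} is disconnected with probability at most α.) -/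
theorem min_le_two_div_mul {N t : ℝ} (hN : 0 < N) (ht0 : 0 ≤ t) (htN : t ≤ N) :
    min t (N - t) ≤ 2 / N * (t * (N - t)) := by
  rw [div_mul_eq_mul_div, le_div_iff₀ hN]
  rcases le_total t (N - t) with h | h
  · rw [min_eq_left h]; nlinarith
  · rw [min_eq_right h]; nlinarith

theorem rpow_cut_le {N t : ℕ} (ht0 : 0 < t) (htN : t < N) {x : ℝ} (hx0 : 0 < x) (hx1 : x ≤ 1) :
    x ^ ((2 : ℝ) / N * ((t : ℝ) * ((N : ℝ) - (t : ℝ)))) ≤ x ^ t + x ^ (N - t) := by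
  have hN : (0 : ℝ) < N := by exact_mod_cast ht0.trans htN
  have htN' : (t : ℝ) ≤ N := by exact_mod_cast htN.le
  refine (Real.rpow_le_rpow_of_exponent_ge hx0 hx1
    (min_le_two_div_mul hN t.cast_nonneg htN')).trans ?_
  rw [← Nat.cast_sub htN.le]
  rcases min_choice (t : ℝ) ((N - t : ℕ) : ℝ) with h | h <;> rw [h, Real.rpow_natCast]
  · exact le_add_of_nonneg_right (by positivity)
  · exact le_add_of_nonneg_left (by positivity)

theorem sum_Ico_choose_mul_pow_add_pow_le {N : ℕ} (hN : 1 ≤ N) {x : ℝ} (hx : 0 ≤ x) :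
    ∑ t ∈ Finset.Ico 1 N, (N.choose t : ℝ) * (x ^ t + x ^ (N - t)) ≤ 2 * ((1 + x) ^ N - 1) := by
  have h₁ := add_pow x 1 N
  have h₂ := add_pow 1 x N
  rw [Finset.sum_range_succ, Finset.range_eq_Ico, Finset.sum_eq_sum_Ico_succ_bot hN] at h₁ h₂
  simp only [one_pow, mul_one, one_mul, pow_zero, Nat.sub_zero, Nat.sub_self, zero_add,
    Nat.choose_zero_right, Nat.choose_self, Nat.cast_one] at h₁ h₂
  simp only [mul_comm (Nat.cast (Nat.choose _ _) : ℝ), add_mul, Finset.sum_add_distrib]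
  rw [add_comm x 1] at h₁
  have := pow_nonneg hx N
  linarith

/-- The union-bound estimate over all cuts:
`Σ_{t=1}^{N-1} C(N,t) · (α/(3N))^{(2/N)·t(N−t)} ≤ α` for every `N ≥ 1` and `α ∈ (0,1]`. -/
theorem cut_union_bound (N : ℕ) (hN : 1 ≤ N) (α : ℝ) (hα0 : 0 < α) (hα1 : α ≤ 1) :
    ∑ t ∈ Finset.Ico 1 N,
      (N.choose t : ℝ) *
        (α / (3 * N)) ^ ((2 : ℝ) / N * ((t : ℝ) * ((N : ℝ) - (t : ℝ)))) ≤ α := by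
  have hN' : (1 : ℝ) ≤ N := by exact_mod_cast hN
  set x : ℝ := α / (3 * N) with hx
  have hx0 : 0 < x := by positivity
  have hx1 : x ≤ 1 := by
    rw [hx, div_le_one (by positivity)]
    linarith
  have hNx : N * x = α / 3 := by
    rw [hx]
    field_simp
  have hpow : (1 + x) ^ N ≤ Real.exp (α / 3) := by
    rw [← hNx, Real.exp_nat_mul]
    gcongr
    linarith [Real.add_one_le_exp x]
  have hexp : Real.exp (α / 3) - 1 - α / 3 ≤ (α / 3) ^ 2 :=
    (le_abs_self _).trans (Real.abs_exp_sub_one_sub_id_le (by rw [abs_le]; constructor <;> linarith))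
  calc _ ≤ ∑ t ∈ Finset.Ico 1 N, (N.choose t : ℝ) * (x ^ t + x ^ (N - t)) := by
        refine Finset.sum_le_sum fun t ht => ?_
        rw [Finset.mem_Ico] at ht
        exact mul_le_mul_of_nonneg_left (rpow_cut_le ht.1 ht.2 hx0 hx1) (Nat.cast_nonneg _)
    _ ≤ 2 * ((1 + x) ^ N - 1) := sum_Ico_choose_mul_pow_add_pow_le hN hx0.le
    _ ≤ α := by nlinarith
end

section
/- Let U be a finite set and let x, y ∈ U be distinct. Consider the two partitions of U: P¹ = ({x,y}, ∅, U∖{x,y}) and P² = ({x}, {y}, U∖{x,y}). Then for every 2-element subset {u,v} ⊆ U with {u,v} ≠ {x,y}, the number of parts of P¹ intersecting {u,v} equals the number of parts of P² intersecting {u,v}; that is, count under P¹ and count under P² agree on every pair query except the pair {x,y} itself (where they return 1 and 2 respectively). -/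
/-- For distinct `x, y` in a finite set `U`, the partitions
`P¹ = ({x,y}, ∅, U∖{x,y})` and `P² = ({x}, {y}, U∖{x,y})` give the same answer to
every pair query except `{x,y}` itself, where they answer `1` and `2` respectively. -/
theorem pair_partitions_indistinguishable {U : Type*} [Fintype U] [DecidableEq U]
    (x y : U) (hxy : x ≠ y) :
    let c₁ : U → Fin 3 := fun z => if z = x ∨ z = y then 0 else 2
    let c₂ : U → Fin 3 := fun z => if z = x then 0 else if z = y then 1 else 2
    (∀ q : Finset U, q.card = 2 → q ≠ {x, y} →
      clusterCount c₁ q = clusterCount c₂ q) ∧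
    clusterCount c₁ ({x, y} : Finset U) = 1 ∧
    clusterCount c₂ ({x, y} : Finset U) = 2 := by
  intro c₁ c₂
  refine ⟨fun q hq hne => ?_, ?_, ?_⟩
  · obtain ⟨u, v, huv, rfl⟩ := Finset.card_eq_two.mp hq
    have h₁ : ¬(u = x ∧ v = y) := by
      rintro ⟨rfl, rfl⟩
      exact hne rfl
    have h₂ : ¬(u = y ∧ v = x) := by
      rintro ⟨rfl, rfl⟩
      exact hne (Finset.pair_comm _ _)
    have key : c₁ u = c₁ v ↔ c₂ u = c₂ v := by
      simp only [c₁, c₂]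
      split_ifs <;> simp_all
    simp only [clusterCount, Finset.image_insert, Finset.image_singleton]
    by_cases h : c₁ u = c₁ v
    · simp [h, key.mp h]
    · rw [Finset.card_pair h, Finset.card_pair (mt key.mpr h)]
  · simp [clusterCount, c₁]
  · simp [clusterCount, c₂, hxy.symm]
end

section
/- Let U be a finite set partitioned into clusters C_1 ⊔ ⋯ ⊔ C_k = U, and let S, T ⊆ U be independent sets, i.e., each of S and T contains at most one element of every cluster. Then the number of pairs (x,y) ∈ S × T such that x and y lie in the same cluster equals count(S) + count(T) − count(S ∪ T). Consequently, one edge-count query to the matching M(S,T) (matching x ∈ S to y ∈ T when they share a cluster) can be simulated by three subset queries. -/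
/-- For independent sets `S` and `T`, the same-cluster pairs in `S × T` correspond to the
clusters meeting both `S` and `T`. -/
theorem card_sameCluster_pairs_eq_card_inter {U K : Type*} [DecidableEq K]
    (c : U → K) (S T : Finset U)
    (hS : ∀ x ∈ S, ∀ y ∈ S, c x = c y → x = y)
    (hT : ∀ x ∈ T, ∀ y ∈ T, c x = c y → x = y) :
    ((S ×ˢ T).filter (fun p => c p.1 = c p.2)).card = (S.image c ∩ T.image c).card := by
  refine Finset.card_bij (fun p _ => c p.1) ?_ ?_ ?_
  · rintro ⟨x, y⟩ h
    simp only [Finset.mem_filter, Finset.mem_product] at h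
    exact Finset.mem_inter.2 ⟨Finset.mem_image_of_mem c h.1.1,
      Finset.mem_image.2 ⟨y, h.1.2, h.2.symm⟩⟩
  · rintro ⟨x, y⟩ h ⟨x', y'⟩ h' hc
    simp only [Finset.mem_filter, Finset.mem_product] at h h' hc
    exact Prod.ext (hS x h.1.1 x' h'.1.1 hc)
      (hT y h.1.2 y' h'.1.2 (h.2.symm.trans (hc.trans h'.2)))
  · intro b hb
    obtain ⟨hbS, hbT⟩ := Finset.mem_inter.1 hb
    obtain ⟨x, hx, rfl⟩ := Finset.mem_image.1 hbS
    obtain ⟨y, hy, hxy⟩ := Finset.mem_image.1 hbT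
    exact ⟨(x, y), Finset.mem_filter.2 ⟨Finset.mem_product.2 ⟨hx, hy⟩, hxy.symm⟩, rfl⟩

/-- If `S` and `T` are independent sets (each containing at most one element of every
cluster) in a clustered universe, then the number of same-cluster pairs
`(x,y) ∈ S × T` equals `count(S) + count(T) − count(S ∪ T)`. -/
theorem matching_from_three_queries {U : Type*} [DecidableEq U] {k : ℕ}
    (c : U → Fin k) (S T : Finset U)
    (hS : ∀ x ∈ S, ∀ y ∈ S, c x = c y → x = y)
    (hT : ∀ x ∈ T, ∀ y ∈ T, c x = c y → x = y) :
    ((S ×ˢ T).filter (fun p => c p.1 = c p.2)).card =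
      clusterCount c S + clusterCount c T - clusterCount c (S ∪ T) := by
  rw [card_sameCluster_pairs_eq_card_inter c S T hS hT]
  unfold clusterCount
  rw [Finset.image_union, Finset.card_inter]
end

section
/- Let C_1 ⊔ ⋯ ⊔ C_k = U be a B-balanced k-clustering of a set U with |U| = n, where B ≥ 1, let δ ∈ (0,1), and set q = ⌈e·B²·ln(k/δ)⌉. Let R_1, …, R_q be independent random subsets of U, each formed as the set of ⌈k/B⌉ independent uniform samples from U. Then with probability at least 1 − δ, for every j ∈ [k] there exists i ∈ [q] such that |R_i ∩ C_j| = 1, i.e., every cluster is hit exactly once by at least one of the sampled sets. -/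
open Finset in
/-- The number of `f : Fin (d + 1) → α` with exactly one coordinate in `S` is at most the number
of those whose range meets `S` in exactly one point. -/
theorem card_mul_card_compl_pow_le_card_image_inter_eq_one {α : Type*} [Fintype α]
    [DecidableEq α] (S : Finset α) (d : ℕ) :
    (d + 1) * (#S * #Sᶜ ^ d) ≤ #{f : Fin (d + 1) → α | #(univ.image f ∩ S) = 1} := by
  let T : Fin (d + 1) → Finset (Fin (d + 1) → α) := fun a =>
    Fintype.piFinset fun b => if b = a then S else Sᶜ
  have hT : ∀ a f, f ∈ T a ↔ ∀ b, f b ∈ S ↔ b = a := by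
    intro a f
    simp only [T, Fintype.mem_piFinset]
    refine forall_congr' fun b => ?_
    by_cases h : b = a <;> simp [h]
  have hcard : ∀ a, #(T a) = #S * #Sᶜ ^ d := by
    intro a
    simp only [T, Fintype.card_piFinset, apply_ite Finset.card]
    rw [← Finset.mul_prod_erase univ _ (mem_univ a), if_pos rfl,
      Finset.prod_congr rfl fun b hb => if_neg (Finset.ne_of_mem_erase hb)]
    simp
  have hdisj : ∀ a ∈ (univ : Finset (Fin (d + 1))), ∀ b ∈ univ, a ≠ b → Disjoint (T a) (T b) := by
    intro a _ b _ hab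
    refine Finset.disjoint_left.mpr fun f ha hb => hab ?_
    exact ((hT b f).1 hb a).1 (((hT a f).1 ha a).2 rfl)
  calc (d + 1) * (#S * #Sᶜ ^ d) = #(univ.biUnion T) := by
        rw [Finset.card_biUnion hdisj]; simp [hcard]
    _ ≤ _ := by
        refine Finset.card_le_card fun f hf => ?_
        obtain ⟨a, -, ha⟩ := Finset.mem_biUnion.1 hf
        rw [hT] at ha
        refine Finset.mem_filter.2 ⟨mem_univ _, Finset.card_eq_one.2 ⟨f a, ?_⟩⟩
        ext x
        simp only [mem_inter, mem_image, mem_univ, true_and, mem_singleton]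
        constructor
        · rintro ⟨⟨b, rfl⟩, hb⟩
          rw [(ha b).1 hb]
        · rintro rfl
          exact ⟨⟨a, rfl⟩, (ha a).2 rfl⟩

theorem exp_neg_mul_div_one_sub_le_one_sub_pow (d : ℕ) {p : ℝ} (hp : p < 1) :
    Real.exp (-(d * (p / (1 - p)))) ≤ (1 - p) ^ d := by
  have h : 0 < 1 - p := by linarith
  rw [← mul_neg, Real.exp_nat_mul]
  refine pow_le_pow_left₀ (Real.exp_pos _).le ?_ d
  rw [← Real.le_log_iff_exp_le h]
  refine le_trans (le_of_eq ?_) (Real.one_sub_inv_le_log_of_pos h)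
  field_simp
  ring

/-- Lower bound for the probability that exactly one of `d + 1` independent trials of success
probability `p` succeeds. -/
theorem one_div_exp_one_mul_sq_le_binomial_one (d : ℕ) {p B : ℝ} (hp : 0 < p) (hB : 1 ≤ B)
    (hlow : 1 / B ^ 2 ≤ (d + 1) * p) (hupp : (d + 1) * p ≤ B) (hdp : d * p ≤ 1)
    (hcompl : d = 0 ∨ 1 / (2 * B) ≤ 1 - p) :
    1 / (Real.exp 1 * B ^ 2) ≤ (d + 1) * p * (1 - p) ^ d := by
  have hB0 : 0 < B := by linarith
  have he : (2 : ℝ) ≤ Real.exp 1 := by linarith [Real.add_one_le_exp (1 : ℝ)]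
  have hinv : 1 / (Real.exp 1 * B ^ 2) = Real.exp (-1) * (1 / B ^ 2) := by
    rw [Real.exp_neg]; field_simp
  rcases hcompl with rfl | hcompl
  · have : Real.exp (-1) ≤ 1 := by simp
    rw [hinv, pow_zero, mul_one]
    exact (mul_le_of_le_one_left (by positivity) this).trans hlow
  have hp1 : p < 1 := by
    have : 0 < 1 / (2 * B) := by positivity
    linarith
  have h1p : 0 < 1 - p := by linarith
  have hpow := exp_neg_mul_div_one_sub_le_one_sub_pow d hp1
  rcases le_or_gt ((d + 1) * p) 1 with hle | hgt
  · have : Real.exp (-1) ≤ (1 - p) ^ d := by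
      refine le_trans (Real.exp_le_exp.2 ?_) hpow
      rw [neg_le_neg_iff, ← mul_div_assoc, div_le_one h1p]
      linarith
    rw [hinv, mul_comm]
    exact mul_le_mul hlow this (Real.exp_pos _).le (by positivity)
  rcases Nat.lt_or_ge d 2 with hd | hd
  · have hBB : 1 / (Real.exp 1 * B ^ 2) ≤ 1 / (2 * B) := by
      apply one_div_le_one_div_of_le (by positivity)
      have : B ≤ B ^ 2 := by nlinarith
      exact mul_le_mul he this hB0.le (by positivity)
    interval_cases d
    · norm_num at hgt; linarith
    · rw [pow_one]
      refine (hBB.trans hcompl).trans ?_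
      exact le_mul_of_one_le_left h1p.le hgt.le
  · set y : ℝ := (d + 1) * p with hy
    have hy0 : 0 < y := by linarith
    have hd' : (2 : ℝ) ≤ d := by exact_mod_cast hd
    have hlog : Real.exp (1 - y⁻¹) ≤ y := by
      rw [← Real.le_log_iff_exp_le hy0]
      exact Real.one_sub_inv_le_log_of_pos hy0
    have hy3 : Real.exp (3 * (1 - y⁻¹)) ≤ y ^ 3 := by
      have := pow_le_pow_left₀ (Real.exp_pos _).le hlog 3
      rwa [← Real.exp_nat_mul, Nat.cast_ofNat] at this
    have hexp : -1 ≤ 3 * (1 - y⁻¹) + -(d * (p / (1 - p))) := by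
      have hkey : y ≤ 3 * (1 - p) := by
        have : p * 2 ≤ p * d := mul_le_mul_of_nonneg_left hd' hp.le
        rw [hy]; nlinarith
      have : 3 * (1 - y⁻¹) + -(d * (p / (1 - p))) - -1
          = (y - 1) * (3 * (1 - p) - y) / (y * (1 - p)) := by
        have : (d : ℝ) * p = y - p := by rw [hy]; ring
        rw [← mul_div_assoc, this]
        field_simp
        ring
      have : 0 ≤ (y - 1) * (3 * (1 - p) - y) / (y * (1 - p)) :=
        div_nonneg (mul_nonneg (by linarith) (by linarith)) (by positivity)
      linarith
    have hcube : Real.exp (-1) ≤ y ^ 3 * (1 - p) ^ d := by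
      refine (Real.exp_le_exp.2 hexp).trans ?_
      rw [Real.exp_add]
      exact mul_le_mul hy3 hpow (Real.exp_pos _).le (by positivity)
    have hsq : y ^ 2 ≤ B ^ 2 := pow_le_pow_left₀ hy0.le hupp 2
    rw [hinv, mul_one_div, div_le_iff₀ (by positivity)]
    refine hcube.trans ?_
    have : 0 ≤ y * (1 - p) ^ d := by positivity
    nlinarith [mul_le_mul_of_nonneg_left hsq this]

open Finset in
/-- Union bound over `j` for `q` independent trials, each landing in `G j` with probability at
least `ε`. -/
theorem one_sub_mul_pow_mul_card_le_card_forall_exists_mem {β ι : Type*} [Fintype β]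
    [DecidableEq β] [Fintype ι] (G : ι → Finset β) (q : ℕ) (ε : ℝ)
    (hG : ∀ j, ε * Fintype.card β ≤ #(G j)) :
    (1 - Fintype.card ι * Real.exp (-(q * ε))) * (Fintype.card (Fin q → β) : ℝ) ≤
      #{ω : Fin q → β | ∀ j, ∃ i, ω i ∈ G j} := by
  classical
  let bad : ι → Finset (Fin q → β) := fun j => Fintype.piFinset fun _ => (G j)ᶜ
  have hbad : ∀ j, (#(bad j) : ℝ) ≤ Real.exp (-(q * ε)) * Fintype.card (Fin q → β) := by
    intro j
    have hle : (#(G j)ᶜ : ℝ) ≤ Real.exp (-ε) * Fintype.card β := by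
      have h := Finset.card_add_card_compl (G j)
      have h' : (#(G j) : ℝ) + #(G j)ᶜ = Fintype.card β := by exact_mod_cast h
      have := mul_le_mul_of_nonneg_right (Real.one_sub_le_exp_neg ε)
        (Nat.cast_nonneg (α := ℝ) (Fintype.card β))
      linarith [hG j]
    have := pow_le_pow_left₀ (Nat.cast_nonneg _) hle q
    rw [mul_pow, ← Real.exp_nat_mul, mul_neg] at this
    simpa [bad] using this
  have hcover : (univ : Finset (Fin q → β)) ⊆
      ({ω : Fin q → β | ∀ j, ∃ i, ω i ∈ G j} : Finset _) ∪ univ.biUnion bad := by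
    intro ω _
    by_cases h : ∀ j, ∃ i, ω i ∈ G j
    · simp [h]
    · push Not at h
      obtain ⟨j, hj⟩ := h
      refine mem_union_right _ (mem_biUnion.2 ⟨j, mem_univ _, ?_⟩)
      simpa [bad] using hj
  have hcount : (Fintype.card (Fin q → β) : ℝ) ≤
      #{ω : Fin q → β | ∀ j, ∃ i, ω i ∈ G j} + ∑ j, (#(bad j) : ℝ) := by
    exact_mod_cast (card_le_card hcover).trans
      ((card_union_le _ _).trans (Nat.add_le_add_left card_biUnion_le _))
  have hsum := Finset.sum_le_sum fun j (_ : j ∈ (univ : Finset ι)) => hbad j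
  rw [Finset.sum_const, card_univ, nsmul_eq_mul] at hsum
  linarith

open Finset in
/-- In a partition of `n` points all of whose `k` parts have at least `s` points, every part
misses at least `(k - 1) s` points. -/
theorem card_fiber_add_le_of_forall_le {n k : ℕ} (c : Fin n → Fin k) {s : ℝ}
    (h : ∀ j, s ≤ #{x | c x = j}) (j : Fin k) :
    (#{x | c x = j} : ℝ) + (k - 1) * s ≤ n := by
  have hsum : (n : ℝ) = ∑ i, (#{x | c x = i} : ℝ) := by
    have := Finset.card_eq_sum_card_fiberwise (f := c) (s := univ) (t := univ) (by simp)
    rw [card_univ, Fintype.card_fin] at this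
    exact_mod_cast this
  have hk : 1 ≤ k := j.pos
  have := Finset.card_nsmul_le_sum (univ.erase j) (fun i => (#{x | c x = i} : ℝ)) s fun i _ => h i
  rw [nsmul_eq_mul, card_erase_of_mem (mem_univ j), card_univ, Fintype.card_fin,
    Nat.cast_sub hk, Nat.cast_one] at this
  rw [hsum, ← Finset.add_sum_erase univ _ (mem_univ j)]
  linarith

open Finset in
/-- In a balanced clustering, `⌈k / B⌉₊` uniform samples hit a given cluster in exactly one point
with probability at least `1 / (e B²)`. -/
theorem exactly_one_hit_card_lower_bound {n k : ℕ} (hn : 1 ≤ n) {B : ℝ} (hB : 1 ≤ B)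
    (c : Fin n → Fin k)
    (hbal : ∀ j, (n : ℝ) / (B * k) ≤ #{x | c x = j} ∧ (#{x | c x = j} : ℝ) ≤ B * n / k)
    (j : Fin k) :
    1 / (Real.exp 1 * B ^ 2) * (Fintype.card (Fin ⌈(k : ℝ) / B⌉₊ → Fin n) : ℝ) ≤
      #{f : Fin ⌈(k : ℝ) / B⌉₊ → Fin n | #(univ.image f ∩ ({x | c x = j} : Finset _)) = 1} := by
  have hB0 : 0 < B := by linarith
  have hk : 1 ≤ k := j.pos
  have hk0 : (0 : ℝ) < k := by exact_mod_cast hk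
  have hn0 : (0 : ℝ) < n := by exact_mod_cast hn
  have hkB : 0 < (k : ℝ) / B := by positivity
  obtain ⟨hlow, hupp⟩ := hbal j
  have hfiber := card_fiber_add_le_of_forall_le c (fun j => (hbal j).1) j
  have hle : (k : ℝ) / B ≤ ⌈(k : ℝ) / B⌉₊ := Nat.le_ceil _
  have hlt := Nat.ceil_lt_add_one hkB.le
  have hrk : ⌈(k : ℝ) / B⌉₊ ≤ k := Nat.ceil_le.2 (div_le_self hk0.le hB)
  obtain ⟨d, hd⟩ := Nat.exists_eq_succ_of_ne_zero (Nat.ceil_pos.2 hkB).ne'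
  rw [Nat.succ_eq_add_one] at hd
  rw [hd] at hle hlt hrk ⊢
  push_cast at hle hlt
  have hdB : (d : ℝ) < k / B := by linarith
  have hrk' : (d : ℝ) + 1 ≤ k := by exact_mod_cast hrk
  have hcount := card_mul_card_compl_pow_le_card_image_inter_eq_one
    ({x | c x = j} : Finset (Fin n)) d
  have hcomp := Finset.card_add_card_compl ({x | c x = j} : Finset (Fin n))
  set S : Finset (Fin n) := {x | c x = j}
  rw [Fintype.card_fin] at hcomp
  have hcomp' : (#Sᶜ : ℝ) = n - #S := by
    rw [eq_sub_iff_add_eq']; exact_mod_cast hcomp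
  set p : ℝ := #S / n with hp
  have hS : (#S : ℝ) = p * n := by rw [hp]; field_simp
  clear_value p
  rw [hS] at hlow hupp hfiber hcomp'
  have hplow : 1 / (B * k) ≤ p := by
    rw [div_le_iff₀ (by positivity)] at hlow ⊢
    nlinarith
  have hpupp : p ≤ B / k := by
    rw [le_div_iff₀ hk0] at hupp ⊢
    nlinarith
  have hp0 : 0 < p := lt_of_lt_of_le (by positivity) hplow
  have hbin := one_div_exp_one_mul_sq_le_binomial_one d hp0 hB
    (calc 1 / B ^ 2 = k / B * (1 / (B * k)) := by field_simp
      _ ≤ (d + 1) * p := by gcongr)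
    (calc ((d : ℝ) + 1) * p ≤ k * (B / k) := by gcongr
      _ = B := by field_simp)
    (calc (d : ℝ) * p ≤ k / B * (B / k) := by gcongr
      _ = 1 := by field_simp)
    (by
      rcases Nat.eq_zero_or_pos d with h | h
      · exact Or.inl h
      right
      have hd1 : (1 : ℝ) ≤ d := by exact_mod_cast h
      have : (k - 1) * ((n : ℝ) / (B * k)) = (k - 1) / (B * k) * n := by ring
      rw [this, ← add_mul] at hfiber
      have h1 : p + (k - 1) / (B * k) ≤ 1 := by nlinarith
      have h2 : 1 / (2 * B) ≤ (k - 1) / (B * k) := by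
        rw [div_le_div_iff₀ (by positivity) (by positivity)]
        nlinarith
      linarith)
  calc 1 / (Real.exp 1 * B ^ 2) * (Fintype.card (Fin (d + 1) → Fin n) : ℝ)
      = 1 / (Real.exp 1 * B ^ 2) * n ^ (d + 1) := by simp
    _ ≤ (d + 1) * p * (1 - p) ^ d * n ^ (d + 1) := by gcongr
    _ = (((d + 1) * (#S * #Sᶜ ^ d) : ℕ) : ℝ) := by
        push_cast
        rw [hcomp', hS, show (n : ℝ) - p * n = (1 - p) * n by ring, mul_pow]
        ring
    _ ≤ _ := by exact_mod_cast hcount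


/-- For a `B`-balanced `k`-clustering of `Fin n` and `δ ∈ (0,1)`, take
`q = ⌈e·B²·ln(k/δ)⌉` independent random subsets `R_1, …, R_q` of the universe, each
formed as the set of `⌈k/B⌉` independent uniform samples (the sample space being
`Fin q → Fin ⌈k/B⌉ → Fin n` with the uniform measure, phrased here by counting).
Then with probability at least `1 - δ`, every cluster is hit exactly once by at least
one of the sampled sets. -/
theorem balanced_clusters_hit_exactly_once (n k : ℕ) (hn : 1 ≤ n) (hk : 1 ≤ k)
    (B : ℝ) (hB : 1 ≤ B) (c : Fin n → Fin k)
    (hbal : ∀ j : Fin k,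
      (n : ℝ) / (B * k) ≤ ((Finset.univ.filter (fun x => c x = j)).card : ℝ) ∧
      ((Finset.univ.filter (fun x => c x = j)).card : ℝ) ≤ B * n / k)
    (δ : ℝ) (hδ0 : 0 < δ) (hδ1 : δ < 1) :
    let q := ⌈Real.exp 1 * B ^ 2 * Real.log (k / δ)⌉₊
    let r := ⌈(k : ℝ) / B⌉₊
    (1 - δ) * (Fintype.card (Fin q → Fin r → Fin n) : ℝ) ≤
      ((Finset.univ.filter (fun ω : Fin q → Fin r → Fin n =>
          ∀ j : Fin k, ∃ i : Fin q,
            ((Finset.image (ω i) Finset.univ) ∩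
              (Finset.univ.filter (fun x => c x = j))).card = 1)).card : ℝ) := by
  intro q r
  have hδk : 0 < δ / k := div_pos hδ0 (by exact_mod_cast hk)
  have hmem : ∀ j, (1 / (Real.exp 1 * B ^ 2)) * (Fintype.card (Fin r → Fin n) : ℝ) ≤ _ :=
    exactly_one_hit_card_lower_bound hn hB c hbal
  have hunion := one_sub_mul_pow_mul_card_le_card_forall_exists_mem _ q _ hmem
  simp only [Finset.mem_filter, Finset.mem_univ, true_and] at hunion
  refine le_trans (mul_le_mul_of_nonneg_right ?_ (Nat.cast_nonneg _)) hunion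
  have hk0 : (0 : ℝ) < k := by exact_mod_cast hk
  have hB0 : 0 < B := by linarith
  have hexp : Real.exp (-(q * (1 / (Real.exp 1 * B ^ 2)))) ≤ δ / k := by
    rw [← Real.le_log_iff_exp_le hδk, ← inv_div (k : ℝ) δ, Real.log_inv, neg_le_neg_iff, mul_one_div,
      le_div_iff₀ (by positivity), mul_comm]
    exact Nat.le_ceil _
  have := mul_le_mul_of_nonneg_left hexp hk0.le
  rw [mul_div_cancel₀ _ hk0.ne'] at this
  rw [Fintype.card_fin]
  linarith
end
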